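/- Let x ∈ 𝕆 with x ≠ 0 and let q ∈ 𝕆. Then a = q · conj(x) · (|x|²)⁻¹ is the unique octonion a satisfying a x = q, where |x|² = x · conj(x) is a positive real number. -/

import Mathlib

noncomputable section

/-- The octonions, as the Cayley–Dickson double of the quaternions. -/
def Octonion : Type := Quaternion ℝ × Quaternion ℝ

namespace Octonion

instance : AddCommGroup Octonion :=
  inferInstanceAs (AddCommGroup (Quaternion ℝ × Quaternion ℝ))

instance : Module ℝ Octonion :=
  inferInstanceAs (Module ℝ (Quaternion ℝ × Quaternion ℝ))

/-- Cayley–Dickson multiplication: (a,b)·(c,d) = (a c − conj(d) b, d a + b conj(c)). -/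
instance : Mul Octonion :=
  ⟨fun x y => (x.1 * y.1 - star y.2 * x.2, y.2 * x.1 + x.2 * star y.1)⟩

instance : One Octonion := ⟨((1 : Quaternion ℝ), 0)⟩

/-- Octonionic conjugation: conj (a,b) = (conj a, −b). -/
def conj (x : Octonion) : Octonion := (star x.1, -x.2)

/-- Real part of an octonion. -/
def re (x : Octonion) : ℝ := x.1.re

/-- Imaginary part of an octonion. -/
def im (x : Octonion) : Octonion := x - re x • 1

/-- Embedding of the reals into the octonions. -/
def ofReal (r : ℝ) : Octonion := (((r : ℝ) : Quaternion ℝ), 0)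

/-- The squared norm |w|² (the real scalar such that w · conj w = |w|² · 1). -/
def normSq (x : Octonion) : ℝ := Quaternion.normSq x.1 + Quaternion.normSq x.2

/-- The imaginary unit i. -/
def i : Octonion := ((⟨0, 1, 0, 0⟩ : Quaternion ℝ), 0)

/-- The imaginary unit j. -/
def j : Octonion := ((⟨0, 0, 1, 0⟩ : Quaternion ℝ), 0)

/-- The imaginary unit k. -/
def k : Octonion := ((⟨0, 0, 0, 1⟩ : Quaternion ℝ), 0)

/-- The imaginary unit ℓ. -/
def l : Octonion := ((0 : Quaternion ℝ), (1 : Quaternion ℝ))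

/-- The associator [x,y,z] = (xy)z − x(yz). -/
def assoc (x y z : Octonion) : Octonion := x * y * z - x * (y * z)

/-- A Jordan matrix: a 3×3 Hermitian matrix over the octonions. -/
def IsHermitian (A : Matrix (Fin 3) (Fin 3) Octonion) : Prop :=
  ∀ p q : Fin 3, conj (A q p) = A p q

/-- The right eigenvalue equation `A v = v λ`, componentwise. -/
def Eig (A : Matrix (Fin 3) (Fin 3) Octonion) (v : Fin 3 → Octonion) (lam : Octonion) : Prop :=
  ∀ p : Fin 3, A p 0 * v 0 + A p 1 * v 1 + A p 2 * v 2 = v p * lam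

end Octonion

namespace Octonion

lemma ext_components {x y : Octonion} (h₁ : x.1 = y.1) (h₂ : x.2 = y.2) : x = y :=
  Prod.ext h₁ h₂

lemma mul_fst (x y : Octonion) : (x * y).1 = x.1 * y.1 - star y.2 * x.2 := rfl

lemma mul_snd (x y : Octonion) : (x * y).2 = y.2 * x.1 + x.2 * star y.1 := rfl

lemma smul_fst (r : ℝ) (x : Octonion) : (r • x).1 = r • x.1 := rfl

lemma smul_snd (r : ℝ) (x : Octonion) : (r • x).2 = r • x.2 := rfl

lemma conj_fst (x : Octonion) : (conj x).1 = star x.1 := rfl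

lemma conj_snd (x : Octonion) : (conj x).2 = -x.2 := rfl

lemma smul_mul (r : ℝ) (x y : Octonion) : (r • x) * y = r • (x * y) := by
  apply ext_components <;>
    simp [mul_fst, mul_snd, smul_fst, smul_snd, smul_sub, smul_add]

lemma conj_conj (x : Octonion) : conj (conj x) = x :=
  ext_components (star_star x.1) (neg_neg x.2)

lemma normSq_conj (x : Octonion) : normSq (conj x) = normSq x := by
  simp [normSq, conj_fst, conj_snd]

lemma mul_conj_self (x : Octonion) : x * conj x = ofReal (normSq x) := by
  apply ext_components
  · simp [mul_fst, conj_fst, conj_snd, ofReal, normSq, Quaternion.self_mul_star, Quaternion.star_mul_self]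
  · simp [mul_snd, conj_fst, conj_snd, ofReal]

/-- An instance of right alternativity: `(a x) x̄ = |x|² a`. -/
lemma mul_mul_conj_cancel (a x : Octonion) : a * x * conj x = normSq x • a := by
  apply ext_components <;> ext <;>
    simp [mul_fst, mul_snd, smul_fst, smul_snd, conj_fst, conj_snd, normSq, Quaternion.normSq_def'] <;> ring

lemma mul_conj_mul_cancel (a x : Octonion) : a * conj x * x = normSq x • a := by
  simpa only [conj_conj, normSq_conj] using mul_mul_conj_cancel a (conj x)

lemma normSq_pos {x : Octonion} (hx : x ≠ 0) : 0 < normSq x := by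
  have h₁ : 0 ≤ Quaternion.normSq x.1 := Quaternion.normSq_nonneg
  have h₂ : 0 ≤ Quaternion.normSq x.2 := Quaternion.normSq_nonneg
  refine (add_nonneg h₁ h₂).lt_of_ne' fun h => hx ?_
  obtain ⟨h₁, h₂⟩ := (add_eq_zero_iff_of_nonneg h₁ h₂).1 h
  exact ext_components (Quaternion.normSq_eq_zero.1 h₁) (Quaternion.normSq_eq_zero.1 h₂)

end Octonion

open Octonion in
/-- For nonzero `x`, the equation `a x = q` has the unique solution
`a = q · conj(x) · (|x|²)⁻¹`, where `|x|² = x · conj(x)` is a positive real number. -/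
theorem right_division (x : Octonion) (hx : x ≠ 0) (q : Octonion) :
    (x * conj x = ofReal (normSq x) ∧ 0 < normSq x) ∧
    ((normSq x)⁻¹ • (q * conj x)) * x = q ∧
    (∀ a : Octonion, a * x = q → a = (normSq x)⁻¹ • (q * conj x)) := by
  have hpos := normSq_pos hx
  refine ⟨⟨mul_conj_self x, hpos⟩, ?_, ?_⟩
  · rw [smul_mul, mul_conj_mul_cancel, inv_smul_smul₀ hpos.ne']
  · rintro a rfl
    rw [mul_mul_conj_cancel, inv_smul_smul₀ hpos.ne']
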